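/- Fix a length-T economy E^T, a family of conjectures Φ, and a matching m* in the non-recursively defined candidate set M*(Φ) = {m ∈ M_T : for all t ∈ {1,…,T}, the restriction of m_t to the one-period economy E_{t,φ_t}(m^{t−1}) induced by the period-t conjectures at history m^{t−1} is a stable matching of that economy}. Suppose that for all t ≥ 1 and all agents k available in period t with m*_t(k) = k one has m* ∈ φ_t(m*^{t−1},k). Then for every t ≥ 1, the restriction of (m*_s)_{s=t}^T to the continuation economy E_t^T(m*^{t−1}) is a Φ-solution of E_t^T(m*^{t−1}), i.e., (m*_s)_{s=t}^T ∈ Σ^Φ_{T−t+1}(E_t^T(m*^{t−1})). -/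

import Mathlib

/-!
A framework for two-sided, one-to-one, irreversible dynamic matching markets
with conjectures, following Doval's "A framework for (dynamic) stability".

Periods are indexed `0, …, T-1` (the paper's periods `1, …, T`).
-/

namespace DynMatch

open Classical

noncomputable section

/-- A length-`T` two-sided dynamic economy: the arrivals on each side in each period. -/
structure Economy (A B : Type) where
  T : ℕ
  arrA : ℕ → Finset A
  arrB : ℕ → Finset B

/-- Validity of an economy: positive length, pairwise disjoint arrivals, and
no arrivals outside the horizon. -/
def Economy.Valid {A B : Type} (E : Economy A B) : Prop :=
  0 < E.T ∧
  (∀ s t, s ≠ t → Disjoint (E.arrA s) (E.arrA t)) ∧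
  (∀ s t, s ≠ t → Disjoint (E.arrB s) (E.arrB t)) ∧
  (∀ s, E.T ≤ s → E.arrA s = ∅) ∧ (∀ s, E.T ≤ s → E.arrB s = ∅)

/-- A raw dynamic matching: in every period, a partial pairing between the two sides
(`none` means unmatched, i.e. matched to oneself). -/
structure PreMatching (A B : Type) where
  mA : ℕ → A → Option B
  mB : ℕ → B → Option A

variable {A B : Type} [DecidableEq A] [DecidableEq B]

/-- Side-`A` agents having arrived up to (and including) period `t`. -/
def arrAUpTo (E : Economy A B) (t : ℕ) : Finset A := (Finset.range (t+1)).biUnion E.arrA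

/-- Side-`B` agents having arrived up to (and including) period `t`. -/
def arrBUpTo (E : Economy A B) (t : ℕ) : Finset B := (Finset.range (t+1)).biUnion E.arrB

/-- `m` is an irreversible dynamic matching for the economy `E`: in every period it is
an involutive pairing between arrived agents of the two sides, and once matched a
pair stays matched. -/
def IsMatching (E : Economy A B) (m : PreMatching A B) : Prop :=
  (∀ t a b, t < E.T → (m.mA t a = some b ↔ m.mB t b = some a)) ∧
  (∀ t a, t < E.T → m.mA t a ≠ none → a ∈ arrAUpTo E t) ∧
  (∀ t a b, t < E.T → m.mA t a = some b → b ∈ arrBUpTo E t) ∧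
  (∀ t s a, t ≤ s → s < E.T → m.mA t a ≠ none → m.mA s a = m.mA t a) ∧
  (∀ t s b, t ≤ s → s < E.T → m.mB t b ≠ none → m.mB s b = m.mB t b)

/-- The everywhere-unmatched prematching. -/
def emptyM : PreMatching A B := ⟨fun _ _ => none, fun _ _ => none⟩

/-- An agent of the economy: a side-`A` or a side-`B` agent. -/
abbrev Agent (A B : Type) := A ⊕ B

/-- `𝒜_t(m^{t-1})`: side-`A` agents available to match in period `t` given history `m`. -/
def availA (E : Economy A B) (m : PreMatching A B) (t : ℕ) : Finset A :=
  (arrAUpTo E t).filter fun a => ∀ s, s < t → m.mA s a = none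

/-- `ℬ_t(m^{t-1})`: side-`B` agents available to match in period `t` given history `m`. -/
def availB (E : Economy A B) (m : PreMatching A B) (t : ℕ) : Finset B :=
  (arrBUpTo E t).filter fun b => ∀ s, s < t → m.mB s b = none

/-- `k ∈ 𝒜_t(m^{t-1}) ∪ ℬ_t(m^{t-1})`. -/
def isAvail (E : Economy A B) (m : PreMatching A B) (t : ℕ) : Agent A B → Prop
  | Sum.inl a => a ∈ availA E m t
  | Sum.inr b => b ∈ availB E m t

/-- `k ∈ A_1 ∪ B_1`: `k` is a first-period arrival. -/
def inPeriodOne (E : Economy A B) : Agent A B → Prop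
  | Sum.inl a => a ∈ E.arrA 0
  | Sum.inr b => b ∈ E.arrB 0

/-- `m_t(k) = k`: agent `k` is unmatched in period `t` under `m`. -/
def unmatchedAt (m : PreMatching A B) (t : ℕ) : Agent A B → Prop
  | Sum.inl a => m.mA t a = none
  | Sum.inr b => m.mB t b = none

/-- `m` and `m'` agree in all periods `s < t` (i.e. they share the history `m^{t-1}`). -/
def agreeUpTo (m m' : PreMatching A B) (t : ℕ) : Prop :=
  ∀ s, s < t → (∀ a, m.mA s a = m'.mA s a) ∧ (∀ b, m.mB s b = m'.mB s b)

/-- Agent `k` is unmatched through period `t` (all periods `s ≤ t`) under `m`. -/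
def unmatchedThrough (m : PreMatching A B) (t : ℕ) : Agent A B → Prop
  | Sum.inl a => ∀ s, s ≤ t → m.mA s a = none
  | Sum.inr b => ∀ s, s ≤ t → m.mB s b = none

/-- `M_T(m^{t-1})`: matchings of `E` agreeing with `m` through period `t-1`. -/
def MSetH (E : Economy A B) (m : PreMatching A B) (t : ℕ) : Set (PreMatching A B) :=
  {m' | IsMatching E m' ∧ agreeUpTo m m' t}

/-- `M_T(m^{t-1}, k)`: matchings of `E` agreeing with `m` through period `t-1` and
leaving `k` unmatched through period `t`. -/
def MSet (E : Economy A B) (m : PreMatching A B) (t : ℕ) (k : Agent A B) :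
    Set (PreMatching A B) :=
  {m' | IsMatching E m' ∧ agreeUpTo m m' t ∧ unmatchedThrough m' t k}

/-- Preferences: Bernoulli utilities on both sides and discount factors.
(The payoff of remaining single is normalized to `0`.) -/
structure Pref (A B : Type) where
  u : A → B → ℝ
  v : A → B → ℝ
  dA : A → ℝ
  dB : B → ℝ

/-- Discount factors lie in `[0,1]`. -/
def Pref.Valid (P : Pref A B) : Prop :=
  (∀ a, 0 ≤ P.dA a ∧ P.dA a ≤ 1) ∧ (∀ b, 0 ≤ P.dB b ∧ P.dB b ≤ 1)

/-- `t_m(a)`: the first period `s ≥ t` at which `a` is matched under `m` (`T` if never). -/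
def matchTimeA (E : Economy A B) (m : PreMatching A B) (t : ℕ) (a : A) : ℕ :=
  min (sInf {s | t ≤ s ∧ m.mA s a ≠ none}) E.T

/-- `t_m(b)`: the first period `s ≥ t` at which `b` is matched under `m` (`T` if never). -/
def matchTimeB (E : Economy A B) (m : PreMatching A B) (t : ℕ) (b : B) : ℕ :=
  min (sInf {s | t ≤ s ∧ m.mB s b ≠ none}) E.T

/-- `U_t(a,m) = δ_a^{t_m(a)-t}·u(a, m_T(a))` (and `0` if `a` ends up unmatched). -/
def Upay (P : Pref A B) (E : Economy A B) (m : PreMatching A B) (t : ℕ) (a : A) : ℝ :=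
  match m.mA (E.T - 1) a with
  | none => 0
  | some b => P.dA a ^ (matchTimeA E m t a - t) * P.u a b

/-- `V_t(b,m) = δ_b^{t_m(b)-t}·v(m_T(b), b)` (and `0` if `b` ends up unmatched). -/
def Vpay (P : Pref A B) (E : Economy A B) (m : PreMatching A B) (t : ℕ) (b : B) : ℝ :=
  match m.mB (E.T - 1) b with
  | none => 0
  | some a => P.dB b ^ (matchTimeB E m t b - t) * P.v a b

/-- A family of conjectures `Φ`: for every period `t`, history `m^{t-1}` and agent `k`,
a set `φ_t(m^{t-1},k)` of matchings `k` considers possible upon remaining unmatched. -/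
abbrev ConjFam (A B : Type) := ℕ → PreMatching A B → Agent A B → Set (PreMatching A B)

/-- Validity of a family of conjectures for `E`: conjectures are (nonempty) subsets of
`M_T(m^{t-1},k)` and depend on the matching only through the history `m^{t-1}`. -/
def ConjFam.Valid (E : Economy A B) (φ : ConjFam A B) : Prop :=
  (∀ t m k, φ t m k ⊆ MSet E m t k) ∧
  (∀ t m m' k, agreeUpTo m m' t → φ t m k = φ t m' k) ∧
  (∀ t m k, t < E.T → IsMatching E m → isAvail E m t k → (φ t m k).Nonempty)

/-- `m` is a `Φ`-solution for `E` (Definition 3): in every period, every available agent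
weakly prefers `m` to some conjectured matching, and no available pair blocks. -/
def IsSolution (P : Pref A B) (E : Economy A B) (φ : ConjFam A B)
    (m : PreMatching A B) : Prop :=
  IsMatching E m ∧
  ∀ t, t < E.T →
    ((∀ a ∈ availA E m t, ∃ m' ∈ φ t m (Sum.inl a), Upay P E m' t a ≤ Upay P E m t a) ∧
     (∀ b ∈ availB E m t, ∃ m' ∈ φ t m (Sum.inr b), Vpay P E m' t b ≤ Vpay P E m t b) ∧
     (∀ a ∈ availA E m t, ∀ b ∈ availB E m t,
        ¬(P.u a b > Upay P E m t a ∧ P.v a b > Vpay P E m t b)))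

/-- `Σ^Φ_T(E)`: the set of `Φ`-solutions of `E`. -/
def SolSet (P : Pref A B) (E : Economy A B) (φ : ConjFam A B) : Set (PreMatching A B) :=
  {m | IsSolution P E φ m}

/-- The static (Gale–Shapley) notion of stability, for length-1 economies:
individual rationality plus absence of blocking pairs. -/
def Stable1 (P : Pref A B) (E : Economy A B) (m : PreMatching A B) : Prop :=
  IsMatching E m ∧
  (∀ a b, m.mA (E.T - 1) a = some b → 0 ≤ P.u a b) ∧
  (∀ b a, m.mB (E.T - 1) b = some a → 0 ≤ P.v a b) ∧
  (∀ a ∈ E.arrA 0, ∀ b ∈ E.arrB 0,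
     ¬(P.u a b > Upay P E m 0 a ∧ P.v a b > Vpay P E m 0 b))

/-- The worst (minimal) period-`t` payoff of `a` over the set `C (inl a)` of matchings. -/
def wA (P : Pref A B) (E : Economy A B) (t : ℕ)
    (C : Agent A B → Set (PreMatching A B)) (a : A) : ℝ :=
  sInf ((fun m' => Upay P E m' t a) '' C (Sum.inl a))

/-- The worst (minimal) period-`t` payoff of `b` over the set `C (inr b)` of matchings. -/
def wB (P : Pref A B) (E : Economy A B) (t : ℕ)
    (C : Agent A B → Set (PreMatching A B)) (b : B) : ℝ :=
  sInf ((fun m' => Vpay P E m' t b) '' C (Sum.inr b))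

/-- Utility of side-`A` agent `a` in the induced one-period economy with outside
option value `W a` (truncated preferences). -/
def indU (P : Pref A B) (W : A → ℝ) (a : A) : Option B → ℝ
  | none => W a
  | some b => P.u a b

/-- Utility of side-`B` agent `b` in the induced one-period economy with outside
option value `W b` (truncated preferences). -/
def indV (P : Pref A B) (W : B → ℝ) (b : B) : Option A → ℝ
  | none => W b
  | some a => P.v a b

/-- The period-`t` component of `mbar` is a stable matching of the one-period economy
`E_{t,φ}(m^{t-1})` induced by the conjecture profile `C` (Definition 6): matching among
the available agents, individually rational w.r.t. the worst-conjecture thresholds,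
and without blocking pairs in the truncated preferences. -/
def StableInduced (P : Pref A B) (E : Economy A B) (m : PreMatching A B) (t : ℕ)
    (C : Agent A B → Set (PreMatching A B)) (mbar : PreMatching A B) : Prop :=
  (∀ a ∈ availA E m t, ∀ b, mbar.mA t a = some b → b ∈ availB E m t ∧ mbar.mB t b = some a) ∧
  (∀ b ∈ availB E m t, ∀ a, mbar.mB t b = some a → a ∈ availA E m t ∧ mbar.mA t a = some b) ∧
  (∀ a ∈ availA E m t, ∀ b, mbar.mA t a = some b → wA P E t C a ≤ P.u a b) ∧
  (∀ b ∈ availB E m t, ∀ a, mbar.mB t b = some a → wB P E t C b ≤ P.v a b) ∧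
  (∀ a ∈ availA E m t, ∀ b ∈ availB E m t,
     ¬(P.u a b > indU P (wA P E t C) a (mbar.mA t a) ∧
       P.v a b > indV P (wB P E t C) b (mbar.mB t b)))

/-- `mbar_t` is stable among those who match in period `t` relative to the conjecture
profile `C` (Definition 7): every available agent matched in period `t` weakly prefers
its partner to its worst conjectured matching, and no pair of agents both matched in
period `t` blocks. -/
def StableAmongMatched (P : Pref A B) (E : Economy A B) (m : PreMatching A B) (t : ℕ)
    (C : Agent A B → Set (PreMatching A B)) (mbar : PreMatching A B) : Prop :=
  (∀ a ∈ availA E m t, ∀ b, mbar.mA t a = some b → wA P E t C a ≤ P.u a b) ∧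
  (∀ b ∈ availB E m t, ∀ a, mbar.mB t b = some a → wB P E t C b ≤ P.v a b) ∧
  (∀ a ∈ availA E m t, ∀ b ∈ availB E m t, ∀ b' a',
     mbar.mA t a = some b' → mbar.mB t b = some a' →
     ¬(P.u a b > P.u a b' ∧ P.v a b > P.v a' b))

/-- `E_t^T(m^{t-1})`: the continuation economy starting at period `t` given history `m`:
its first-period arrivals are the agents available at `t`, later arrivals are unchanged. -/
def contEconomy (E : Economy A B) (m : PreMatching A B) (t : ℕ) : Economy A B where
  T := E.T - t
  arrA := fun s => if s = 0 then availA E m t else E.arrA (t + s)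
  arrB := fun s => if s = 0 then availB E m t else E.arrB (t + s)

/-- The restriction of `m` to the continuation economy starting in period `t`:
time is shifted by `t` and agents matched strictly before `t` are dropped. -/
def restrictM (m : PreMatching A B) (t : ℕ) : PreMatching A B where
  mA := fun s a => if ∀ s', s' < t → m.mA s' a = none then m.mA (t + s) a else none
  mB := fun s b => if ∀ s', s' < t → m.mB s' b = none then m.mB (t + s) b else none

/-- The matching of the original economy corresponding to history `m` through period
`t-1` followed by the continuation matching `m'` (indexed from `0`) of the
continuation economy. -/
def splice (m m' : PreMatching A B) (t : ℕ) : PreMatching A B where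
  mA := fun s a => if s < t then m.mA s a
    else if ∀ s', s' < t → m.mA s' a = none then m'.mA (s - t) a
    else m.mA (t - 1) a
  mB := fun s b => if s < t then m.mB s b
    else if ∀ s', s' < t → m.mB s' b = none then m'.mB (s - t) b
    else m.mB (t - 1) b

/-- The family of conjectures that the family `φ` of the original economy induces on the
continuation economy `E_t^T(m^{t-1})`: at a continuation history, it is the (restriction
of the) original conjectures at the corresponding original history. -/
def contConj (E : Economy A B) (φ : ConjFam A B) (m : PreMatching A B) (t : ℕ) :
    ConjFam A B :=
  fun s mbar k => (fun m' => restrictM m' t) '' φ (t + s) (splice m mbar t) k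

/-- The conjectures of eq. (2): the agent only rules out continuation matchings that do
not conform with the solution concept `S` from tomorrow onward. -/
def starConj (S : Economy A B → Set (PreMatching A B)) (E : Economy A B) : ConjFam A B :=
  fun t m k =>
    {m' | m' ∈ MSet E m t k ∧ restrictM m' (t+1) ∈ S (contEconomy E m' (t+1))}

/-- `S` is the solution correspondence `Σ*` recursively generated by the conjectures of
eq. (2): stability for one-period economies, `Φ*`-solutions for longer economies
(empty continuations impose no restriction). -/
def IsStarFamily (P : Pref A B) (S : Economy A B → Set (PreMatching A B)) : Prop :=
  (∀ E : Economy A B, E.T = 0 → S E = Set.univ) ∧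
  (∀ E : Economy A B, E.T = 1 → S E = {m | Stable1 P E m}) ∧
  (∀ E : Economy A B, 2 ≤ E.T → S E = SolSet P E (starConj S E))

/-- The decreasing recursion defining the CVR conjectures at period `t`, history `m`,
relative to the continuation solution correspondence `DS`. -/
def cvrIter (P : Pref A B) (E : Economy A B)
    (DS : Economy A B → Set (PreMatching A B)) (t : ℕ) (m : PreMatching A B) :
    ℕ → Agent A B → Set (PreMatching A B)
  | 0 => fun k => MSet E m t k
  | n+1 => fun k =>
      {mbar | mbar ∈ MSet E m t k ∧
        StableAmongMatched P E m t (cvrIter P E DS t m n) mbar ∧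
        restrictM mbar (t+1) ∈ DS (contEconomy E mbar (t+1))}

/-- The CVR conjectures `φ_{D̂S,t}(m^{t-1},·)`: the limit (intersection) of the
decreasing recursion `cvrIter`. -/
def cvrConj (P : Pref A B) (DS : Economy A B → Set (PreMatching A B))
    (E : Economy A B) : ConjFam A B :=
  fun t m k => ⋂ n, cvrIter P E DS t m n k

/-- `DS` is the CVR-dynamic-stability correspondence `D̂S`: stable matchings for
one-period economies, `Φ_{D̂S}`-solutions for longer economies. -/
def IsCVRFamily (P : Pref A B) (DS : Economy A B → Set (PreMatching A B)) : Prop :=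
  (∀ E : Economy A B, E.T = 0 → DS E = Set.univ) ∧
  (∀ E : Economy A B, E.T = 1 → DS E = {m | Stable1 P E m}) ∧
  (∀ E : Economy A B, 2 ≤ E.T → DS E = SolSet P E (cvrConj P DS E))

/-- The dynamic-stability conjectures of Doval (2022): the period-`t` matching is stable
among those who match relative to individually rational continuation values, and the
continuation is dynamically stable. -/
def dsConj (P : Pref A B) (DSol : Economy A B → Set (PreMatching A B))
    (E : Economy A B) : ConjFam A B :=
  fun t m k =>
    {mbar | mbar ∈ MSet E m t k ∧
      (∀ a ∈ availA E m t, ∀ b, mbar.mA t a = some b → 0 ≤ P.u a b) ∧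
      (∀ b ∈ availB E m t, ∀ a, mbar.mB t b = some a → 0 ≤ P.v a b) ∧
      (∀ a ∈ availA E m t, ∀ b ∈ availB E m t, ∀ b' a',
         mbar.mA t a = some b' → mbar.mB t b = some a' →
         ¬(P.u a b > P.u a b' ∧ P.v a b > P.v a' b)) ∧
      restrictM mbar (t+1) ∈ DSol (contEconomy E mbar (t+1))}

/-- `DSol` is the dynamic-stability correspondence `DS` of Doval (2022). -/
def IsDSFamily (P : Pref A B) (DSol : Economy A B → Set (PreMatching A B)) : Prop :=
  (∀ E : Economy A B, E.T = 0 → DSol E = Set.univ) ∧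
  (∀ E : Economy A B, E.T = 1 → DSol E = {m | Stable1 P E m}) ∧
  (∀ E : Economy A B, 2 ≤ E.T → DSol E = SolSet P E (dsConj P DSol E))

/-- `E_{\k}`: the economy identical to `E` except that agent `k`'s arrival is delayed
by one period (from period `0` to period `1`). -/
def delayEconomy (E : Economy A B) : Agent A B → Economy A B
  | Sum.inl a =>
      { T := E.T
        arrA := fun s => if s = 0 then E.arrA 0 \ {a}
                 else if s = 1 then insert a (E.arrA 1) else E.arrA s
        arrB := E.arrB }
  | Sum.inr b =>
      { T := E.T
        arrA := E.arrA
        arrB := fun s => if s = 0 then E.arrB 0 \ {b}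
                 else if s = 1 then insert b (E.arrB 1) else E.arrB s }

/-- The candidate set `M*(m^{t-1}, C, Scont)`: matchings whose period-`t` matching is
stable in the one-period economy induced by the continuation-value sets `C`, and whose
continuation lies in `Scont` of the induced continuation economy. -/
def candT (P : Pref A B) (Scont : Economy A B → Set (PreMatching A B))
    (E : Economy A B) (t : ℕ) (m : PreMatching A B)
    (C : Agent A B → Set (PreMatching A B)) : Set (PreMatching A B) :=
  {mbar | mbar ∈ MSetH E m t ∧ StableInduced P E m t C mbar ∧
    restrictM mbar (t+1) ∈ Scont (contEconomy E mbar (t+1))}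

/-- The increasing recursion `F_n` defining the sophisticated-dynamic-stability
conjectures at period `t`, history `m`, relative to the correspondence `SDS` on
strictly shorter problems. -/
def sdsF (P : Pref A B) (SDS : Economy A B → Set (PreMatching A B))
    (E : Economy A B) (t : ℕ) (m : PreMatching A B) :
    ℕ → Agent A B → Set (PreMatching A B)
  | 0 => fun k =>
      {mbar | mbar ∈ MSet E m t k ∧
        restrictM mbar t ∈ SDS (delayEconomy (contEconomy E m t) k)}
  | n+1 => fun k => sdsF P SDS E t m n k ∪
      {mbar | mbar ∈ candT P SDS E t m (sdsF P SDS E t m n) ∧ unmatchedAt mbar t k}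

/-- The SDS conjectures `φ_{SDS,t}`: the limit (union) of the increasing recursion `F_n`. -/
def sdsConj (P : Pref A B) (SDS : Economy A B → Set (PreMatching A B))
    (E : Economy A B) : ConjFam A B :=
  fun t m k => ⋃ n, sdsF P SDS E t m n k

/-- `SDS` is the sophisticated-dynamic-stability correspondence. -/
def IsSDSFamily (P : Pref A B) (SDS : Economy A B → Set (PreMatching A B)) : Prop :=
  (∀ E : Economy A B, E.T = 0 → SDS E = Set.univ) ∧
  (∀ E : Economy A B, E.T = 1 → SDS E = {m | Stable1 P E m}) ∧
  (∀ E : Economy A B, 2 ≤ E.T → SDS E = SolSet P E (sdsConj P SDS E))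

/-- The rational-expectations conjectures: `k` conjectures exactly the `RE` solutions of
the continuation economy in which `k`'s arrival is delayed by one period. -/
def reConj (RE : Economy A B → Set (PreMatching A B)) (E : Economy A B) : ConjFam A B :=
  fun t m k =>
    {mbar | mbar ∈ MSet E m t k ∧
      restrictM mbar t ∈ RE (delayEconomy (contEconomy E m t) k)}

/-- `RE` is the rational-expectations solution correspondence. -/
def IsREFamily (P : Pref A B) (RE : Economy A B → Set (PreMatching A B)) : Prop :=
  (∀ E : Economy A B, E.T = 1 → RE E = {m | Stable1 P E m}) ∧
  (∀ E : Economy A B, 2 ≤ E.T → RE E = SolSet P E (reConj RE E))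

/-- The matching with the two sides exchanged. -/
def PreMatching.swap {A B : Type} (m : PreMatching A B) : PreMatching B A := ⟨m.mB, m.mA⟩

/-- The economy with the two sides exchanged. -/
def Economy.swap {A B : Type} (E : Economy A B) : Economy B A := ⟨E.T, E.arrB, E.arrA⟩

/-- The preferences with the two sides exchanged. -/
def Pref.swap {A B : Type} (P : Pref A B) : Pref B A :=
  ⟨fun b a => P.v a b, fun b a => P.u a b, P.dB, P.dA⟩

lemma IsMatching.swap {E : Economy A B} {m : PreMatching A B} (h : IsMatching E m) :
    IsMatching E.swap m.swap := by
  obtain ⟨h1, h2, h3, h4, h5⟩ := h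
  refine ⟨fun t b a ht => (h1 t a b ht).symm, fun t b ht hb => ?_, fun t b a ht hb => ?_, h5, h4⟩
  · obtain ⟨a, ha⟩ := Option.ne_none_iff_exists'.mp hb
    exact h3 t a b ht ((h1 t a b ht).mpr ha)
  · have hab := (h1 t a b ht).mpr hb
    exact h2 t a ht (by simp [hab])

lemma Economy.Valid.swap {E : Economy A B} (h : E.Valid) : E.swap.Valid :=
  ⟨h.1, h.2.2.1, h.2.1, h.2.2.2.2, h.2.2.2.1⟩

lemma Vpay_eq_swap (P : Pref A B) (E : Economy A B) (m : PreMatching A B) (t : ℕ) (b : B) :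
    Vpay P E m t b = Upay P.swap E.swap m.swap t b := rfl

lemma contEconomy_swap (E : Economy A B) (m : PreMatching A B) (t : ℕ) :
    (contEconomy E m t).swap = contEconomy E.swap m.swap t := rfl

lemma restrictM_swap (m : PreMatching A B) (t : ℕ) :
    (restrictM m t).swap = restrictM m.swap t := rfl

/-- The period-`t` payoff of an agent already matched in period `t` is undiscounted. -/
lemma Upay_of_matched {P : Pref A B} {E : Economy A B} {m : PreMatching A B}
    (hm : IsMatching E m) {t : ℕ} (ht : t < E.T) {a : A} {b : B} (hab : m.mA t a = some b) :
    Upay P E m t a = P.u a b := by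
  have hlast : m.mA (E.T - 1) a = some b := by
    rw [hm.2.2.2.1 t (E.T - 1) a (by omega) (by omega) (by simp [hab]), hab]
  have hle : sInf {s | t ≤ s ∧ m.mA s a ≠ none} ≤ t :=
    Nat.sInf_le ⟨le_rfl, by simp [hab]⟩
  have htime : matchTimeA E m t a - t = 0 := by
    unfold matchTimeA
    omega
  simp [Upay, hlast, htime]

lemma Vpay_of_matched {P : Pref A B} {E : Economy A B} {m : PreMatching A B}
    (hm : IsMatching E m) {t : ℕ} (ht : t < E.T) {a : A} {b : B} (hab : m.mB t b = some a) :
    Vpay P E m t b = P.v a b := by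
  rw [Vpay_eq_swap]
  exact Upay_of_matched hm.swap ht hab

/-- An agent has only finitely many possible payoffs. -/
lemma finite_Upay_image (P : Pref A B) (E : Economy A B) (hT : 0 < E.T) (t : ℕ) (a : A)
    {S : Set (PreMatching A B)} (hS : ∀ m ∈ S, IsMatching E m) :
    ((fun m => Upay P E m t a) '' S).Finite := by
  refine Set.Finite.subset (s := insert 0
    ((fun x : ℕ × B => P.dA a ^ x.1 * P.u a x.2) ''
      ↑(Finset.range (E.T + 1) ×ˢ arrBUpTo E (E.T - 1)))) ?_ ?_
  · exact (Set.Finite.image _ (Finset.finite_toSet _)).insert _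
  · rintro _ ⟨m, hmS, rfl⟩
    cases hlast : m.mA (E.T - 1) a with
    | none => left; simp [Upay, hlast]
    | some b =>
      right
      refine ⟨(matchTimeA E m t a - t, b), ?_, by simp [Upay, hlast]⟩
      have hb := (hS m hmS).2.2.1 (E.T - 1) a b (by omega) hlast
      have : matchTimeA E m t a ≤ E.T := min_le_right _ _
      simp only [Finset.coe_product, Set.mem_prod, Finset.mem_coe, Finset.mem_range]
      exact ⟨by omega, hb⟩

lemma finite_Vpay_image (P : Pref A B) (E : Economy A B) (hT : 0 < E.T) (t : ℕ) (b : B)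
    {S : Set (PreMatching A B)} (hS : ∀ m ∈ S, IsMatching E m) :
    ((fun m => Vpay P E m t b) '' S).Finite := by
  have h := finite_Upay_image P.swap E.swap hT t b (S := PreMatching.swap '' S)
    (by rintro _ ⟨m, hm, rfl⟩; exact (hS m hm).swap)
  rwa [Set.image_image] at h

/-- The payoff in a continuation economy of an agent unmatched before it starts is the
payoff in the original economy. -/
lemma Upay_restrictM (P : Pref A B) (E : Economy A B) (m₀ m : PreMatching A B) {t s : ℕ}
    (hts : t + s < E.T) {a : A} (ha : ∀ r < t, m.mA r a = none) :
    Upay P (contEconomy E m₀ t) (restrictM m t) s a = Upay P E m (t + s) a := by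
  have hr : ∀ r, (restrictM m t).mA r a = m.mA (t + r) a := fun r => if_pos ha
  have hT : (contEconomy E m₀ t).T = E.T - t := rfl
  have hidx : t + (E.T - t - 1) = E.T - 1 := by omega
  unfold Upay
  rw [hr, hT, hidx]
  cases hlast : m.mA (E.T - 1) a with
  | none => rfl
  | some b =>
    have hshift : sInf {r | s ≤ r ∧ m.mA (t + r) a ≠ none} + t =
        sInf {r | t + s ≤ r ∧ m.mA r a ≠ none} := by
      have hmem : E.T - 1 ∈ {r | t + s ≤ r ∧ m.mA r a ≠ none} :=
        ⟨by omega, by simp [hlast]⟩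
      have hle : t ≤ sInf {r | t + s ≤ r ∧ m.mA r a ≠ none} := by
        have := (Nat.sInf_mem ⟨_, hmem⟩).1
        omega
      rw [← Nat.sInf_add hle]
      refine congrArg (sInf · + t) (Set.ext fun r => ?_)
      change s ≤ r ∧ m.mA (t + r) a ≠ none ↔ t + s ≤ r + t ∧ m.mA (r + t) a ≠ none
      rw [Nat.add_comm r t]
      exact and_congr_left fun _ => by omega
    have htime : matchTimeA (contEconomy E m₀ t) (restrictM m t) s a - s =
        matchTimeA E m (t + s) a - (t + s) := by
      simp only [matchTimeA, hr, hT]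
      omega
    simp only [htime]

lemma Vpay_restrictM (P : Pref A B) (E : Economy A B) (m₀ m : PreMatching A B) {t s : ℕ}
    (hts : t + s < E.T) {b : B} (hb : ∀ r < t, m.mB r b = none) :
    Vpay P (contEconomy E m₀ t) (restrictM m t) s b = Vpay P E m (t + s) b := by
  simp only [Vpay_eq_swap, contEconomy_swap, restrictM_swap]
  exact Upay_restrictM P.swap E.swap m₀.swap m.swap hts hb

/-- No agent is matched before arriving. -/
lemma IsMatching.eq_none_of_lt_arrival {E : Economy A B} {m : PreMatching A B}
    (hm : IsMatching E m) (hE : E.Valid) {a : A} {r n : ℕ} (ha : a ∈ E.arrA n) (hr : r < n) :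
    m.mA r a = none := by
  by_contra h
  have hn : n < E.T := by
    by_contra! hn
    simp [hE.2.2.2.1 n hn] at ha
  have hmem := hm.2.1 r a (by omega) h
  simp only [arrAUpTo, Finset.mem_biUnion, Finset.mem_range] at hmem
  obtain ⟨j, hj, haj⟩ := hmem
  exact Finset.disjoint_left.mp (hE.2.1 j n (by omega)) haj ha

lemma mem_availA_of_mem_cont {E : Economy A B} {m : PreMatching A B} (hm : IsMatching E m)
    (hE : E.Valid) {t s : ℕ} {a : A}
    (ha : a ∈ availA (contEconomy E m t) (restrictM m t) s) : a ∈ availA E m (t + s) := by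
  simp only [availA, arrAUpTo, Finset.mem_filter, Finset.mem_biUnion, Finset.mem_range] at ha ⊢
  obtain ⟨⟨j, hj, haj⟩, hun⟩ := ha
  have key : (∃ i, i < t + s + 1 ∧ a ∈ E.arrA i) ∧ ∀ r < t, m.mA r a = none := by
    by_cases hj0 : j = 0
    · subst hj0
      simp only [contEconomy, if_true, availA, arrAUpTo, Finset.mem_filter, Finset.mem_biUnion,
        Finset.mem_range] at haj
      obtain ⟨⟨i, hi, hai⟩, h⟩ := haj
      exact ⟨⟨i, by omega, hai⟩, h⟩
    · simp only [contEconomy, hj0, if_false] at haj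
      exact ⟨⟨t + j, by omega, haj⟩, fun r hr => hm.eq_none_of_lt_arrival hE haj (by omega)⟩
  refine ⟨key.1, fun r hr => ?_⟩
  by_cases hrt : r < t
  · exact key.2 r hrt
  · have h := hun (r - t) (by omega)
    simp only [restrictM] at h
    rwa [if_pos key.2, Nat.add_sub_cancel' (by omega)] at h

lemma mem_availB_of_mem_cont {E : Economy A B} {m : PreMatching A B} (hm : IsMatching E m)
    (hE : E.Valid) {t s : ℕ} {b : B}
    (hb : b ∈ availB (contEconomy E m t) (restrictM m t) s) : b ∈ availB E m (t + s) :=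
  mem_availA_of_mem_cont hm.swap hE.swap hb

/-- Agents present by period `t + s` and unmatched before `t` belong to the continuation
economy by its period `s`. -/
lemma mem_arrAUpTo_cont {E : Economy A B} {m : PreMatching A B} {t s : ℕ} {a : A}
    (ha : a ∈ arrAUpTo E (t + s)) (hun : ∀ r < t, m.mA r a = none) :
    a ∈ arrAUpTo (contEconomy E m t) s := by
  simp only [arrAUpTo, Finset.mem_biUnion, Finset.mem_range] at ha ⊢
  obtain ⟨j, hj, haj⟩ := ha
  by_cases hjt : j ≤ t
  · refine ⟨0, by omega, ?_⟩
    simp only [contEconomy, if_true, availA, arrAUpTo, Finset.mem_filter, Finset.mem_biUnion,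
      Finset.mem_range]
    exact ⟨⟨j, by omega, haj⟩, hun⟩
  · refine ⟨j - t, by omega, ?_⟩
    simp only [contEconomy]
    rwa [if_neg (by omega), Nat.add_sub_cancel' (by omega)]

lemma mem_arrBUpTo_cont {E : Economy A B} {m : PreMatching A B} {t s : ℕ} {b : B}
    (hb : b ∈ arrBUpTo E (t + s)) (hun : ∀ r < t, m.mB r b = none) :
    b ∈ arrBUpTo (contEconomy E m t) s :=
  mem_arrAUpTo_cont (E := E.swap) (m := m.swap) hb hun

/-- The partner of an agent unmatched before `t` was unmatched before `t` too. -/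
lemma IsMatching.partner_unmatched {E : Economy A B} {m : PreMatching A B}
    (hm : IsMatching E m) {t n : ℕ} (htn : t ≤ n) (hn : n < E.T) {a : A} {b : B}
    (hab : m.mA n a = some b) (ha : ∀ r < t, m.mA r a = none) : ∀ r < t, m.mB r b = none := by
  intro r hr
  by_contra hne
  have h1 := hm.2.2.2.2 r n b (by omega) hn hne
  rw [(hm.1 n a b hn).mp hab] at h1
  have h2 := (hm.1 r a b (by omega)).mpr h1.symm
  simp [ha r hr] at h2

lemma restrictM_mA_eq_some {m : PreMatching A B} {t s : ℕ} {a : A} {b : B} :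
    (restrictM m t).mA s a = some b ↔
      (∀ r < t, m.mA r a = none) ∧ m.mA (t + s) a = some b := by
  by_cases h : ∀ r < t, m.mA r a = none
  · simp only [restrictM, if_pos h]
    exact ⟨fun h' => ⟨h, h'⟩, And.right⟩
  · simp [restrictM, h]

lemma restrictM_mB_eq_some {m : PreMatching A B} {t s : ℕ} {a : A} {b : B} :
    (restrictM m t).mB s b = some a ↔
      (∀ r < t, m.mB r b = none) ∧ m.mB (t + s) b = some a :=
  restrictM_mA_eq_some (m := m.swap)

/-- Irreversibility is inherited by restrictions. -/
lemma IsMatching.restrictM_mA_persists {E : Economy A B} {m : PreMatching A B}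
    (hm : IsMatching E m) {t r s : ℕ} {a : A} (hrs : r ≤ s) (hs : s < E.T - t)
    (hne : (restrictM m t).mA r a ≠ none) :
    (restrictM m t).mA s a = (restrictM m t).mA r a := by
  obtain ⟨b, hb⟩ := Option.ne_none_iff_exists'.mp hne
  obtain ⟨hun, h⟩ := restrictM_mA_eq_some.mp hb
  rw [hb, restrictM_mA_eq_some]
  exact ⟨hun, by rw [hm.2.2.2.1 (t + r) (t + s) a (by omega) (by omega) (by simp [h]), h]⟩

lemma IsMatching.restrictM {E : Economy A B} {m : PreMatching A B} (hm : IsMatching E m)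
    (t : ℕ) : IsMatching (contEconomy E m t) (restrictM m t) := by
  have hT : (contEconomy E m t).T = E.T - t := rfl
  refine ⟨fun s a b hs => ?_, fun s a hs hne => ?_, fun s a b hs hab => ?_,
    fun r s a hrs hs hne => hm.restrictM_mA_persists hrs hs hne,
    fun r s b hrs hs hne => hm.swap.restrictM_mA_persists (E := E.swap) hrs hs hne⟩
  · rw [hT] at hs
    rw [restrictM_mA_eq_some, restrictM_mB_eq_some, hm.1 (t + s) a b (by omega)]
    refine and_congr_left fun h => ⟨fun hun => ?_, fun hun => ?_⟩
    · exact hm.partner_unmatched (n := t + s) (by omega) (by omega)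
        ((hm.1 _ _ _ (by omega)).mpr h) hun
    · exact hm.swap.partner_unmatched (n := t + s) (by omega) (by simp only [Economy.swap]; omega)
        h hun
  · rw [hT] at hs
    obtain ⟨b, hb⟩ := Option.ne_none_iff_exists'.mp hne
    obtain ⟨hun, h⟩ := restrictM_mA_eq_some.mp hb
    exact mem_arrAUpTo_cont (hm.2.1 (t + s) a (by omega) (by simp [h])) hun
  · rw [hT] at hs
    obtain ⟨hun, h⟩ := restrictM_mA_eq_some.mp hab
    exact mem_arrBUpTo_cont (hm.2.2.1 (t + s) a b (by omega) h)
      (hm.partner_unmatched (by omega) (by omega) h hun)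

/-- Splicing a matching with its own restriction recovers the matching. -/
lemma IsMatching.splice_mA_self {E : Economy A B} {m : PreMatching A B} (hm : IsMatching E m)
    {t r : ℕ} (hr : r < E.T) (a : A) : (splice m (DynMatch.restrictM m t) t).mA r a = m.mA r a := by
  simp only [splice, DynMatch.restrictM]
  by_cases hrt : r < t
  · rw [if_pos hrt]
  · rw [if_neg hrt]
    by_cases hun : ∀ q < t, m.mA q a = none
    · rw [if_pos hun, if_pos hun, Nat.add_sub_cancel' (by omega)]
    · rw [if_neg hun]
      push Not at hun
      obtain ⟨q, hq, hne⟩ := hun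
      rw [hm.2.2.2.1 q (t - 1) a (by omega) (by omega) hne,
        hm.2.2.2.1 q r a (by omega) hr hne]

lemma IsMatching.contConj_restrictM {E : Economy A B} {φ : ConjFam A B}
    (hφ : ConjFam.Valid E φ) {m : PreMatching A B} (hm : IsMatching E m) {t s : ℕ}
    (hts : t + s < E.T) (k : Agent A B) :
    contConj E φ m t s (DynMatch.restrictM m t) k =
      (fun m' => DynMatch.restrictM m' t) '' φ (t + s) m k := by
  unfold contConj
  rw [hφ.2.1 (t + s) (splice m (DynMatch.restrictM m t) t) m k]
  exact fun r hr => ⟨fun a => hm.splice_mA_self (by omega) a,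
    fun b => hm.swap.splice_mA_self (E := E.swap) (r := r)
      (show r < E.T by omega) b⟩

/-- A matching in the candidate set that satisfies the consistency condition is a solution
at every period: no available agent and no available pair wants to deviate. -/
lemma no_deviation {P : Pref A B} {E : Economy A B} {φ : ConjFam A B}
    (hφ : ConjFam.Valid E φ) {m : PreMatching A B} (hm : IsMatching E m) {t : ℕ} (ht : t < E.T)
    (hst : StableInduced P E m t (φ t m) m)
    (hcc : ∀ k : Agent A B, isAvail E m t k → unmatchedAt m t k → m ∈ φ t m k) :
    (∀ a ∈ availA E m t, ∃ m' ∈ φ t m (Sum.inl a), Upay P E m' t a ≤ Upay P E m t a) ∧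
    (∀ b ∈ availB E m t, ∃ m' ∈ φ t m (Sum.inr b), Vpay P E m' t b ≤ Vpay P E m t b) ∧
    (∀ a ∈ availA E m t, ∀ b ∈ availB E m t,
      ¬(P.u a b > Upay P E m t a ∧ P.v a b > Vpay P E m t b)) := by
  obtain ⟨-, -, hirA, hirB, hblock⟩ := hst
  have hT : 0 < E.T := by omega
  have hIs : ∀ k, ∀ m' ∈ φ t m k, IsMatching E m' := fun k m' h => (hφ.1 t m k h).1
  have hfA := fun a => finite_Upay_image P E hT t a (hIs (Sum.inl a))
  have hfB := fun b => finite_Vpay_image P E hT t b (hIs (Sum.inr b))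
  refine ⟨fun a ha => ?_, fun b hb => ?_, fun a ha b hb hab => ?_⟩
  · cases hmatch : m.mA t a with
    | none => exact ⟨m, hcc (Sum.inl a) ha hmatch, le_rfl⟩
    | some b =>
      obtain ⟨m', hm', heq⟩ :=
        ((hφ.2.2 t m (Sum.inl a) ht hm ha).image (fun m' => Upay P E m' t a)).csInf_mem (hfA a)
      refine ⟨m', hm', ?_⟩
      rw [Upay_of_matched hm ht hmatch]
      exact heq.trans_le (hirA a ha b hmatch)
  · cases hmatch : m.mB t b with
    | none => exact ⟨m, hcc (Sum.inr b) hb hmatch, le_rfl⟩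
    | some a =>
      obtain ⟨m', hm', heq⟩ :=
        ((hφ.2.2 t m (Sum.inr b) ht hm hb).image (fun m' => Vpay P E m' t b)).csInf_mem (hfB b)
      refine ⟨m', hm', ?_⟩
      rw [Vpay_of_matched hm ht hmatch]
      exact heq.trans_le (hirB b hb a hmatch)
  · have hA : indU P (wA P E t (φ t m)) a (m.mA t a) ≤ Upay P E m t a := by
      cases hmatch : m.mA t a with
      | none => exact csInf_le (hfA a).bddBelow ⟨m, hcc (Sum.inl a) ha hmatch, rfl⟩
      | some b => exact (Upay_of_matched hm ht hmatch).ge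
    have hB : indV P (wB P E t (φ t m)) b (m.mB t b) ≤ Vpay P E m t b := by
      cases hmatch : m.mB t b with
      | none => exact csInf_le (hfB b).bddBelow ⟨m, hcc (Sum.inr b) hb hmatch, rfl⟩
      | some a => exact (Vpay_of_matched hm ht hmatch).ge
    exact hblock a ha b hb ⟨hA.trans_lt hab.1, hB.trans_lt hab.2⟩

/-- Theorem 2, non-recursive version: if `m*` lies in the candidate set
`M*(Φ)` (its period-`t` matching is stable in the induced one-period economy
`E_{t,φ_t}(m*^{t-1})` for every `t`) and the consistency condition holds along the path
of `m*`, then for every `t` the restriction of `m*` from `t` onward is a `Φ`-solution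
of the continuation economy `E_t^T(m*^{t-1})`. -/
theorem statement3
    (A B : Type) [DecidableEq A] [DecidableEq B]
    (P : Pref A B) (hP : P.Valid)
    (E : Economy A B) (hE : E.Valid)
    (φ : ConjFam A B) (hφ : ConjFam.Valid E φ)
    (mstar : PreMatching A B) (hm : IsMatching E mstar)
    (hcand : ∀ t, t < E.T → StableInduced P E mstar t (φ t mstar) mstar)
    (hcc : ∀ t, t < E.T → ∀ k : Agent A B, isAvail E mstar t k →
      unmatchedAt mstar t k → mstar ∈ φ t mstar k) :
    ∀ t, t < E.T →
      IsSolution P (contEconomy E mstar t) (contConj E φ mstar t) (restrictM mstar t) := by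
  intro t ht
  refine ⟨hm.restrictM t, fun s hs => ?_⟩
  have hts : t + s < E.T := by
    have : s < E.T - t := hs
    omega
  obtain ⟨hA, hB, hblock⟩ := no_deviation hφ hm hts (hcand _ hts) (hcc _ hts)
  refine ⟨fun a ha => ?_, fun b hb => ?_, fun a ha b hb => ?_⟩
  · have ha' := mem_availA_of_mem_cont hm hE ha
    have hun := (Finset.mem_filter.mp ha').2
    obtain ⟨m', hm', hle⟩ := hA a ha'
    refine ⟨restrictM m' t, ?_, ?_⟩
    · rw [hm.contConj_restrictM hφ hts]
      exact ⟨m', hm', rfl⟩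
    · have hun' := (hφ.1 _ _ _ hm').2.2
      rwa [Upay_restrictM P E mstar m' hts fun r hr => hun' r (by omega),
        Upay_restrictM P E mstar mstar hts fun r hr => hun r (by omega)]
  · have hb' := mem_availB_of_mem_cont hm hE hb
    have hun := (Finset.mem_filter.mp hb').2
    obtain ⟨m', hm', hle⟩ := hB b hb'
    refine ⟨restrictM m' t, ?_, ?_⟩
    · rw [hm.contConj_restrictM hφ hts]
      exact ⟨m', hm', rfl⟩
    · have hun' := (hφ.1 _ _ _ hm').2.2
      rwa [Vpay_restrictM P E mstar m' hts fun r hr => hun' r (by omega),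
        Vpay_restrictM P E mstar mstar hts fun r hr => hun r (by omega)]
  · have ha' := mem_availA_of_mem_cont hm hE ha
    have hb' := mem_availB_of_mem_cont hm hE hb
    rw [Upay_restrictM P E mstar mstar hts
        fun r hr => (Finset.mem_filter.mp ha').2 r (by omega),
      Vpay_restrictM P E mstar mstar hts
        fun r hr => (Finset.mem_filter.mp hb').2 r (by omega)]
    exact hblock a ha' b hb'

end

end DynMatch
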